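/- arXiv:1701.03955 — 3 statements merged into one kernel-verified Lean document; each statement's English description precedes it below -/
import Mathlib

section
/- Let p ∈ [1,∞) and let P be a Borel probability measure on ℝ × 𝒫(ℝ) (where 𝒫(ℝ) carries the weak topology and its Borel σ-algebra) such that ∫ [ d̲(x,0)^p + W_p(ν,δ₀)^p ] P(dx,dν) < ∞. Define the transport value 𝒲(P,Q) := ( inf_{Γ ∈ Π(P,Q)} ∫ [ d̲(x,y)^p + W_p(m,m')^p ] Γ(dx,dm,dy,dm') )^{1/p} for probability measures P, Q on ℝ × 𝒫(ℝ). Then for every ε > 0 there exists μ ∈ 𝒫^p(ℝ²) with 𝒲(I[μ], P) < ε; that is, the image of the embedding I is dense. -/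
open MeasureTheory ProbabilityTheory Filter
open scoped ENNReal NNReal Topology

noncomputable section

/-- `𝒫(ℝ)` (with its weak topology) carries the Borel σ-algebra. -/
instance : MeasurableSpace (ProbabilityMeasure ℝ) := borel _

instance : BorelSpace (ProbabilityMeasure ℝ) := ⟨rfl⟩

/-- `dund` is a metric on `ℝ` inducing the usual topology. -/
structure IsCompatibleMetric (dund : ℝ → ℝ → ℝ) : Prop where
  self_eq_zero : ∀ x, dund x x = 0
  eq_of_dist_eq_zero : ∀ x y, dund x y = 0 → x = y
  symm : ∀ x y, dund x y = dund y x
  triangle : ∀ x y z, dund x z ≤ dund x y + dund y z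
  compatible : ∀ (x : ℝ) (u : ℕ → ℝ),
    Tendsto u atTop (nhds x) ↔ Tendsto (fun n => dund (u n) x) atTop (nhds 0)

/-- Couplings: measures on the product with prescribed marginals. -/
def coupling {α β : Type*} [MeasurableSpace α] [MeasurableSpace β]
    (μ : Measure α) (ν : Measure β) : Set (Measure (α × β)) :=
  {γ | γ.map Prod.fst = μ ∧ γ.map Prod.snd = ν}

/-- The `p`-Wasserstein distance on measures on the line, w.r.t. the base metric `d̲`. -/
def Wp (p : ℝ) (dund : ℝ → ℝ → ℝ) (m m' : Measure ℝ) : ℝ≥0∞ :=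
  (⨅ η : {η : Measure (ℝ × ℝ) // η ∈ coupling m m'},
      ∫⁻ q : ℝ × ℝ, ENNReal.ofReal (dund q.1 q.2 ^ p) ∂(η : Measure (ℝ × ℝ))) ^ (1 / p)

/-- The regular conditional distribution `x ↦ μ^x` of the second coordinate given the
first, as a probability measure on `ℝ` (junk value for non-finite `μ`). -/
def condPM (μ : Measure (ℝ × ℝ)) (x : ℝ) : ProbabilityMeasure ℝ :=
  haveI := Classical.dec (IsFiniteMeasure μ)
  if h : IsFiniteMeasure μ then
    haveI := h
    ⟨μ.condKernel x, inferInstance⟩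
  else ⟨Measure.dirac 0, inferInstance⟩

/-- The embedding `I : 𝒫(ℝ²) → 𝒫(ℝ × 𝒫(ℝ))`, `I[μ] = (x ↦ (x, μ^x))_* μ₁`. -/
def Iemb (μ : Measure (ℝ × ℝ)) : Measure (ℝ × ProbabilityMeasure ℝ) :=
  (μ.map Prod.fst).map (fun x => (x, condPM μ x))

/-- The `p`-th power cost on `ℝ² × ℝ²`. -/
def cost2 (p : ℝ) (dund : ℝ → ℝ → ℝ) (z : (ℝ × ℝ) × (ℝ × ℝ)) : ℝ≥0∞ :=
  ENNReal.ofReal (dund z.1.1 z.2.1 ^ p + dund z.1.2 z.2.2 ^ p)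

/-- Membership in `𝒫^p(ℝ²)`: a probability measure with a finite `p`-th moment. -/
def MemP2 (p : ℝ) (dund : ℝ → ℝ → ℝ) (μ : Measure (ℝ × ℝ)) : Prop :=
  IsProbabilityMeasure μ ∧
    ∃ x₀ : ℝ × ℝ, ∫⁻ x, cost2 p dund (x, x₀) ∂μ < ⊤

/-- The transport value `𝒲(P,Q)` on measures on `ℝ × 𝒫(ℝ)` with cost
`d̲(x,y)^p + W_p(m,m')^p`. -/
def WNested (p : ℝ) (dund : ℝ → ℝ → ℝ)
    (P Q : Measure (ℝ × ProbabilityMeasure ℝ)) : ℝ≥0∞ :=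
  (⨅ Γ : {Γ : Measure ((ℝ × ProbabilityMeasure ℝ) × (ℝ × ProbabilityMeasure ℝ)) //
        Γ ∈ coupling P Q},
      ∫⁻ z : (ℝ × ProbabilityMeasure ℝ) × (ℝ × ProbabilityMeasure ℝ),
        (ENNReal.ofReal (dund z.1.1 z.2.1 ^ p) +
          Wp p dund (z.1.2 : Measure ℝ) (z.2.2 : Measure ℝ) ^ p)
        ∂(Γ : Measure _)) ^ (1 / p)

open Topology

/-- The inclusion of probability measures into measures is measurable for the Borel σ-algebra of
the weak topology. -/
lemma measurable_coe_probabilityMeasure {X : Type*} [TopologicalSpace X] [MeasurableSpace X]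
    [BorelSpace X] [HasOuterApproxClosed X]
    [MeasurableSpace (ProbabilityMeasure X)] [OpensMeasurableSpace (ProbabilityMeasure X)] :
    Measurable (fun ν : ProbabilityMeasure X => (ν : Measure X)) := by
  refine Measurable.measure_of_isPiSystem_of_isProbabilityMeasure
    (BorelSpace.measurable_eq (α := X)) isPiSystem_isOpen fun U hU => ?_
  refine LowerSemicontinuous.measurable ?_
  rw [lowerSemicontinuous_iff_le_liminf]
  exact fun ν => ProbabilityMeasure.le_liminf_measure_open_of_tendsto tendsto_id hU

/-- Pushforward along an open embedding embeds the spaces of probability measures. -/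
lemma isEmbedding_probabilityMeasure_map {X Y : Type*}
    [TopologicalSpace X] [MeasurableSpace X] [BorelSpace X]
    [TopologicalSpace Y] [MeasurableSpace Y] [BorelSpace Y]
    [TopologicalSpace.MetrizableSpace X] [TopologicalSpace.SeparableSpace X]
    [TopologicalSpace.MetrizableSpace Y] [TopologicalSpace.SeparableSpace Y]
    {f : X → Y} (hf : IsOpenEmbedding f) :
    IsEmbedding (fun ν : ProbabilityMeasure X =>
      ν.map hf.continuous.measurable.aemeasurable) := by
  have hcont := ProbabilityMeasure.continuous_map hf.continuous
  have hind : IsInducing (fun ν : ProbabilityMeasure X =>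
      ν.map hf.continuous.measurable.aemeasurable) := by
    rw [isInducing_iff_nhds]
    refine fun ν => le_antisymm (hcont.tendsto ν).le_comap ?_
    refine tendsto_id'.1 (tendsto_of_forall_isOpen_le_liminf' fun G hG => ?_)
    have hGY : IsOpen (f '' G) := hf.isOpenMap G hG
    have key := ProbabilityMeasure.le_liminf_measure_open_of_tendsto
      (tendsto_comap (f := fun ν : ProbabilityMeasure X =>
        ν.map hf.continuous.measurable.aemeasurable)
        (x := 𝓝 (ν.map hf.continuous.measurable.aemeasurable))) hGY
    simpa only [id_eq, ProbabilityMeasure.map_apply' _ _ hGY.measurableSet,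
      Set.preimage_image_eq G hf.injective] using key
  exact hind.isEmbedding

/-- `𝒫(ℝ)` embeds measurably in the line, with a measurable left inverse: it sits as a Borel
subset in the compact metrizable space `𝒫([-∞, ∞])`. -/
lemma exists_measurable_leftInverse_probabilityMeasure_real :
    ∃ (e : ProbabilityMeasure ℝ → ℝ) (g : ℝ → ProbabilityMeasure ℝ),
      Measurable e ∧ Measurable g ∧ ∀ ν, g (e ν) = ν := by
  let : MeasurableSpace (ProbabilityMeasure EReal) := borel _
  have : BorelSpace (ProbabilityMeasure EReal) := ⟨rfl⟩
  have hf : IsOpenEmbedding ((↑) : ℝ → EReal) := EReal.isOpenEmbedding_coe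
  have hemb := isEmbedding_probabilityMeasure_map hf
  have hrange : Set.range (fun ν : ProbabilityMeasure ℝ =>
      ν.map hf.continuous.measurable.aemeasurable) =
      {ν : ProbabilityMeasure EReal | (ν : Measure EReal) (Set.range ((↑) : ℝ → EReal))ᶜ = 0} := by
    ext ν
    simp only [Set.mem_range, Set.mem_ofPred_eq]
    constructor
    · rintro ⟨ν, rfl⟩
      rw [ProbabilityMeasure.map_apply' _ _ hf.isOpen_range.measurableSet.compl]
      simp
    · intro h
      have hm := hf.measurableEmbedding
      have hmap : ((ν : Measure EReal).comap ((↑) : ℝ → EReal)).map ((↑) : ℝ → EReal) = ν := by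
        rw [hm.map_comap]
        exact Measure.restrict_eq_self_of_ae_mem (mem_ae_iff.2 h)
      have hprob : IsProbabilityMeasure ((ν : Measure EReal).comap ((↑) : ℝ → EReal)) := by
        constructor
        have := congrArg (fun m : Measure EReal => m Set.univ) hmap
        simpa [Measure.map_apply hm.measurable MeasurableSet.univ] using this
      exact ⟨⟨_, hprob⟩, Subtype.ext hmap⟩
  have hmeas : MeasurableEmbedding (fun ν : ProbabilityMeasure ℝ =>
      ν.map hf.continuous.measurable.aemeasurable) := by
    refine hemb.measurableEmbedding ?_
    rw [hrange]
    exact (Measure.measurable_coe hf.isOpen_range.measurableSet.compl).comp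
      measurable_coe_probabilityMeasure (measurableSet_singleton 0)
  have : PolishSpace (ProbabilityMeasure EReal) := by
    let := TopologicalSpace.metrizableSpaceMetric (ProbabilityMeasure EReal)
    infer_instance
  have hE := (measurableEmbedding_embeddingReal (ProbabilityMeasure EReal)).comp hmeas
  obtain ⟨g, hg, hgE⟩ := hE.exists_measurable_extend measurable_id
    fun _ => ⟨⟨Measure.dirac 0, inferInstance⟩⟩
  exact ⟨_, g, hE.measurable, hg, fun ν => congrFun hgE ν⟩

lemma exists_measurable_leftInverse_unitInterval :
    ∃ (e : ProbabilityMeasure ℝ → ℝ) (g : ℝ → ProbabilityMeasure ℝ),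
      Measurable e ∧ Measurable g ∧ (∀ ν, g (e ν) = ν) ∧ ∀ ν, e ν ∈ Set.Ioo (0 : ℝ) 1 := by
  obtain ⟨e, g, he, hg, hge⟩ := exists_measurable_leftInverse_probabilityMeasure_real
  refine ⟨fun ν => Real.arctan (e ν) / Real.pi + 1 / 2,
    fun s => g (Real.sin ((s - 1 / 2) * Real.pi) / Real.cos ((s - 1 / 2) * Real.pi)),
    by fun_prop, hg.comp (by fun_prop), fun ν => ?_, fun ν => ?_⟩
  · have : (Real.arctan (e ν) / Real.pi + 1 / 2 - 1 / 2) * Real.pi = Real.arctan (e ν) := by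
      field_simp [Real.pi_ne_zero]
      ring
    simp only [this, ← Real.tan_eq_sin_div_cos, Real.tan_arctan, hge]
  · have h1 := Real.neg_pi_div_two_lt_arctan (e ν)
    have h2 := Real.arctan_lt_pi_div_two (e ν)
    have hpi := Real.pi_pos
    have h3 : -(1 / 2) < Real.arctan (e ν) / Real.pi := by rw [lt_div_iff₀ hpi]; linarith
    have h4 : Real.arctan (e ν) / Real.pi < 1 / 2 := by rw [div_lt_iff₀ hpi]; linarith
    constructor <;> linarith

namespace IsCompatibleMetric

variable {dund : ℝ → ℝ → ℝ}

lemma nonneg (hd : IsCompatibleMetric dund) (x y : ℝ) : 0 ≤ dund x y := by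
  have h := hd.triangle x y x
  rw [hd.self_eq_zero, hd.symm y x] at h
  linarith

lemma continuous (hd : IsCompatibleMetric dund) : Continuous (Function.uncurry dund) := by
  refine continuous_iff_seqContinuous.2 fun u z hu => ?_
  obtain ⟨x, y⟩ := z
  have h1 : Tendsto (fun n => dund (u n).1 x) atTop (𝓝 0) :=
    (hd.compatible x _).1 ((continuous_fst.tendsto _).comp hu)
  have h2 : Tendsto (fun n => dund (u n).2 y) atTop (𝓝 0) :=
    (hd.compatible y _).1 ((continuous_snd.tendsto _).comp hu)
  have h3 := h1.add h2
  rw [add_zero] at h3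
  rw [tendsto_iff_dist_tendsto_zero]
  refine squeeze_zero (fun _ => dist_nonneg) (fun n => ?_) h3
  simp only [Function.comp_apply, Function.uncurry, Real.dist_eq]
  rw [abs_sub_le_iff]
  have t1 := hd.triangle (u n).1 x (u n).2
  have t2 := hd.triangle x y (u n).2
  have t3 := hd.triangle x (u n).1 y
  have t4 := hd.triangle (u n).1 (u n).2 y
  rw [hd.symm y] at t2
  rw [hd.symm x (u n).1] at t3
  constructor <;> linarith

/-- On each unit interval, closeness for `dund` follows from closeness at a uniform scale. -/
lemma exists_scale (hd : IsCompatibleMetric dund) {δ : ℝ} (hδ : 0 < δ) (k : ℤ) :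
    ∃ N : ℕ, 0 < N ∧ ∀ x ∈ Set.Icc (k : ℝ) (k + 1), ∀ y ∈ Set.Icc (k : ℝ) (k + 1),
      |y - x| ≤ 1 / (N : ℝ) → dund y x ≤ δ := by
  have hK : IsCompact (Set.Icc (k : ℝ) (k + 1) ×ˢ Set.Icc (k : ℝ) (k + 1)) :=
    isCompact_Icc.prod isCompact_Icc
  have huc := hK.uniformContinuousOn_of_continuous hd.continuous.continuousOn
  obtain ⟨η, hη, h⟩ := Metric.uniformContinuousOn_iff.1 huc δ hδ
  obtain ⟨n, hn⟩ := exists_nat_one_div_lt hη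
  refine ⟨n + 1, n.succ_pos, fun x hx y hy hxy => ?_⟩
  have := h (y, x) ⟨hy, hx⟩ (x, x) ⟨hx, hx⟩ (by
    rw [Prod.dist_eq, dist_self, max_eq_left dist_nonneg, Real.dist_eq]
    push_cast at hxy
    exact hxy.trans_lt hn)
  rw [Real.dist_eq] at this
  simp only [Function.uncurry, hd.self_eq_zero, sub_zero] at this
  exact (le_abs_self _).trans this.le

end IsCompatibleMetric

/-- A measure on the line can be encoded in an arbitrarily small perturbation of a point. -/
lemma exists_encoding {dund : ℝ → ℝ → ℝ} (hd : IsCompatibleMetric dund) {δ : ℝ} (hδ : 0 < δ) :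
    ∃ (T : ℝ × ProbabilityMeasure ℝ → ℝ) (G : ℝ → ProbabilityMeasure ℝ),
      Measurable T ∧ Measurable G ∧ (∀ z, G (T z) = z.2) ∧ ∀ z, dund (T z) z.1 ≤ δ := by
  obtain ⟨e, g, he, hg, hge, he01⟩ := exists_measurable_leftInverse_unitInterval
  choose N hN hNd using fun k : ℤ => hd.exists_scale hδ k
  have hNm : Measurable (fun x : ℝ => (N ⌊x⌋ : ℝ)) :=
    (measurable_from_top (f := fun k : ℤ => (N k : ℝ))).comp Int.measurable_floor
  have hcast : Measurable (fun k : ℤ => (k : ℝ)) := measurable_from_top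
  refine ⟨fun z => (⌊(N ⌊z.1⌋ : ℝ) * z.1⌋ + e z.2) / N ⌊z.1⌋,
    fun t => g (Int.fract ((N ⌊t⌋ : ℝ) * t)), ?_, ?_, ?_⟩
  · have h1 : Measurable (fun z : ℝ × ProbabilityMeasure ℝ => (N ⌊z.1⌋ : ℝ)) :=
      hNm.comp measurable_fst
    exact ((hcast.comp (h1.mul measurable_fst).floor).add (he.comp measurable_snd)).div h1
  · exact hg.comp (hNm.mul measurable_id).fract
  rw [← forall_and]
  rintro ⟨x, ν⟩
  dsimp only
  set k := ⌊x⌋ with hk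
  set j := ⌊(N k : ℝ) * x⌋ with hj
  have hNpos : (0 : ℝ) < N k := by exact_mod_cast hN k
  obtain ⟨h0, h1⟩ := he01 ν
  have hkx : (k : ℝ) ≤ x := Int.floor_le x
  have hxk : x < k + 1 := Int.lt_floor_add_one x
  have hjx : (j : ℝ) ≤ N k * x := Int.floor_le _
  have hxj : (N k : ℝ) * x < j + 1 := Int.lt_floor_add_one _
  have hj1 : (N k : ℤ) * k ≤ j := by
    rw [hj, Int.le_floor]
    push_cast
    gcongr
  have hj2 : j + 1 ≤ (N k : ℤ) * (k + 1) := by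
    rw [Int.add_one_le_iff, hj, Int.floor_lt]
    push_cast
    gcongr
  have hj1' : (N k : ℝ) * k ≤ j := by exact_mod_cast hj1
  have hj2' : (j : ℝ) + 1 ≤ N k * (k + 1) := by exact_mod_cast hj2
  have hT1 : (k : ℝ) ≤ (j + e ν) / N k := by rw [le_div_iff₀ hNpos]; linarith
  have hT2 : (j + e ν) / N k < (k : ℝ) + 1 := by rw [div_lt_iff₀ hNpos]; linarith
  have hfl : ⌊(j + e ν) / (N k : ℝ)⌋ = k := Int.floor_eq_iff.2 ⟨hT1, hT2⟩
  constructor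
  · rw [hfl, mul_div_cancel₀ _ hNpos.ne', Int.fract_intCast_add,
      Int.fract_eq_self.2 ⟨h0.le, h1⟩, hge]
  · refine hNd k x ⟨hkx, hxk.le⟩ _ ⟨hT1, hT2.le⟩ ?_
    have : (j + e ν) / N k - x = (j + e ν - N k * x) / N k := by field_simp
    rw [this, abs_div, abs_of_pos hNpos]
    gcongr
    rw [abs_le]
    constructor <;> linarith

lemma Wp_self {p : ℝ} (hp : 0 < p) {dund : ℝ → ℝ → ℝ} (hd : IsCompatibleMetric dund)
    (m : Measure ℝ) : Wp p dund m m = 0 := by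
  have hdiag : Measurable (fun x : ℝ => (x, x)) := by fun_prop
  rw [Wp, ENNReal.rpow_eq_zero_iff_of_pos (by positivity), ← le_zero_iff]
  have hmem : m.map (fun x => (x, x)) ∈ coupling m m := by
    constructor
    · rw [Measure.map_map measurable_fst hdiag]; exact Measure.map_id
    · rw [Measure.map_map measurable_snd hdiag]; exact Measure.map_id
  refine (iInf_le _ ⟨_, hmem⟩).trans ((lintegral_map_le _ _).trans ?_)
  simp [hd.self_eq_zero, Real.zero_rpow hp.ne']

lemma lintegral_le_Wp_dirac {p : ℝ} (hp : 0 < p) {dund : ℝ → ℝ → ℝ}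
    (hd : IsCompatibleMetric dund) (m : Measure ℝ) (a : ℝ) :
    ∫⁻ y, ENNReal.ofReal (dund y a ^ p) ∂m ≤ Wp p dund m (Measure.dirac a) ^ p := by
  rw [Wp, ← ENNReal.rpow_mul, one_div_mul_cancel hp.ne', ENNReal.rpow_one]
  refine le_iInf fun ⟨η, hη⟩ => ?_
  obtain ⟨h1, h2⟩ := id hη
  dsimp only
  have hc := hd.continuous
  have hm : Measurable (fun y => ENNReal.ofReal (dund y a ^ p)) := by
    have : Measurable (fun y => dund y a) := (hc.comp (Continuous.prodMk_left a)).measurable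
    fun_prop
  have hfst : ∫⁻ y, ENNReal.ofReal (dund y a ^ p) ∂m =
      ∫⁻ q, ENNReal.ofReal (dund q.1 a ^ p) ∂η := by
    rw [← h1, lintegral_map hm measurable_fst]
  rw [hfst]
  refine (lintegral_congr_ae ?_).le
  have hae : ∀ᵐ q ∂η, q.2 = a := by
    have : ∀ᵐ y ∂(η.map Prod.snd), y = a := by
      rw [h2]; exact (ae_dirac_iff (measurableSet_singleton a)).2 rfl
    exact ae_of_ae_map measurable_snd.aemeasurable this
  filter_upwards [hae] with q hq
  rw [hq]

lemma Iemb_compProd (Q : Measure ℝ) [IsProbabilityMeasure Q] {G : ℝ → ProbabilityMeasure ℝ}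
    (κ : Kernel ℝ ℝ) [IsMarkovKernel κ] (hκ : ∀ t, κ t = (G t : Measure ℝ)) :
    Iemb (Q ⊗ₘ κ) = Q.map (fun t => (t, G t)) := by
  have hfst : (Q ⊗ₘ κ).fst = Q := Measure.fst_compProd Q κ
  have hae := eq_condKernel_of_measure_eq_compProd (ρ := Q ⊗ₘ κ) κ (by rw [hfst])
  rw [Iemb, ← Measure.fst, hfst]
  rw [hfst] at hae
  refine Measure.map_congr ?_
  filter_upwards [hae] with t ht
  have : condPM (Q ⊗ₘ κ) t = G t :=
    (dif_pos (inferInstance : IsFiniteMeasure (Q ⊗ₘ κ))).trans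
      (Subtype.ext (ht.symm.trans (hκ t)))
  rw [this]

/-- every Borel probability measure `P` on `ℝ × 𝒫(ℝ)` with finite `p`-th
moment is approximated arbitrarily well, in the transport value `𝒲`, by images `I[μ]` of
measures `μ ∈ 𝒫^p(ℝ²)`: the image of the embedding `I` is dense. -/
theorem Iemb_range_dense (p : ℝ) (hp : 1 ≤ p)
    (dund : ℝ → ℝ → ℝ) (hd : IsCompatibleMetric dund)
    (P : Measure (ℝ × ProbabilityMeasure ℝ)) [IsProbabilityMeasure P]
    (hmom : ∫⁻ z : ℝ × ProbabilityMeasure ℝ,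
        (ENNReal.ofReal (dund z.1 0 ^ p) +
          Wp p dund (z.2 : Measure ℝ) (Measure.dirac 0) ^ p) ∂P < ⊤) :
    ∀ ε : ℝ≥0∞, 0 < ε →
      ∃ μ : Measure (ℝ × ℝ), MemP2 p dund μ ∧ WNested p dund (Iemb μ) P < ε := by
  intro ε hε
  have hp0 : 0 < p := by linarith
  obtain ⟨δ, hδ0, hδε⟩ : ∃ δ : ℝ, 0 < δ ∧ ENNReal.ofReal δ < ε := by
    obtain ⟨r, hr0, hrε⟩ := ENNReal.lt_iff_exists_nnreal_btwn.1 hε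
    exact ⟨r, by exact_mod_cast hr0, by simpa using hrε⟩
  obtain ⟨T, G, hT, hG, hGT, hTd⟩ := exists_encoding hd hδ0
  let κ : Kernel ℝ ℝ := ⟨fun t => (G t : Measure ℝ), measurable_coe_probabilityMeasure.comp hG⟩
  have : IsMarkovKernel κ := ⟨fun t => inferInstanceAs (IsProbabilityMeasure (G t : Measure ℝ))⟩
  have : IsProbabilityMeasure (P.map T) := Measure.isProbabilityMeasure_map hT.aemeasurable
  have hcost : ∀ a b : ℝ, Measurable fun z : ℝ × ℝ => dund z.1 a ^ p + dund z.2 b ^ p := by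
    intro a b
    have h (a : ℝ) : Measurable (fun y => dund y a) :=
      (hd.continuous.comp (Continuous.prodMk_left a)).measurable
    exact (((h a).comp measurable_fst).pow_const p).add (((h b).comp measurable_snd).pow_const p)
  refine ⟨P.map T ⊗ₘ κ, ⟨inferInstance, (0, 0), ?_⟩, ?_⟩
  · simp only [cost2]
    rw [Measure.lintegral_compProd (hcost 0 0).ennreal_ofReal]
    refine (lintegral_map_le _ _).trans_lt ?_
    have hC : (2 : ℝ≥0∞) ^ (p - 1) ≠ ⊤ := by simp
    calc ∫⁻ z, ∫⁻ y, ENNReal.ofReal (dund (T z) 0 ^ p + dund y 0 ^ p) ∂κ (T z) ∂P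
        ≤ ∫⁻ z, (2 : ℝ≥0∞) ^ (p - 1) * (ENNReal.ofReal δ ^ p +
            (ENNReal.ofReal (dund z.1 0 ^ p) +
              Wp p dund (z.2 : Measure ℝ) (Measure.dirac 0) ^ p)) ∂P := by
          refine lintegral_mono fun z => ?_
          have hκz : κ (T z) = (z.2 : Measure ℝ) :=
            congrArg (fun ν : ProbabilityMeasure ℝ => (ν : Measure ℝ)) (hGT z)
          have h1 : ENNReal.ofReal (dund (T z) 0 ^ p) ≤ (2 : ℝ≥0∞) ^ (p - 1) *
              (ENNReal.ofReal δ ^ p + ENNReal.ofReal (dund z.1 0 ^ p)) := by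
            rw [← ENNReal.ofReal_rpow_of_nonneg (hd.nonneg _ _) hp0.le,
              ← ENNReal.ofReal_rpow_of_nonneg (hd.nonneg _ _) hp0.le]
            refine le_trans ?_ (ENNReal.rpow_add_le_mul_rpow_add_rpow _ _ hp)
            rw [← ENNReal.ofReal_add hδ0.le (hd.nonneg _ _)]
            gcongr
            exact (hd.triangle _ z.1 _).trans (by gcongr; exact hTd z)
          have hC1 : (1 : ℝ≥0∞) ≤ 2 ^ (p - 1) := by
            have h := ENNReal.rpow_le_rpow (one_le_two (α := ℝ≥0∞)) (sub_nonneg.2 hp)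
            rwa [ENNReal.one_rpow] at h
          rw [hκz]
          calc ∫⁻ y, ENNReal.ofReal (dund (T z) 0 ^ p + dund y 0 ^ p) ∂(z.2 : Measure ℝ)
              = ENNReal.ofReal (dund (T z) 0 ^ p) +
                ∫⁻ y, ENNReal.ofReal (dund y 0 ^ p) ∂(z.2 : Measure ℝ) := by
                simp_rw [ENNReal.ofReal_add (Real.rpow_nonneg (hd.nonneg _ _) p)
                  (Real.rpow_nonneg (hd.nonneg _ _) p)]
                rw [lintegral_add_left measurable_const]
                simp
            _ ≤ _ := by
                rw [← add_assoc, mul_add]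
                refine add_le_add h1 ((lintegral_le_Wp_dirac hp0 hd _ 0).trans ?_)
                exact le_mul_of_one_le_left zero_le hC1
      _ = (2 : ℝ≥0∞) ^ (p - 1) * (ENNReal.ofReal δ ^ p + ∫⁻ z, (ENNReal.ofReal (dund z.1 0 ^ p) +
              Wp p dund (z.2 : Measure ℝ) (Measure.dirac 0) ^ p) ∂P) := by
          rw [lintegral_const_mul' _ _ hC, lintegral_add_left measurable_const]
          simp
      _ < ⊤ := ENNReal.mul_lt_top hC.lt_top (ENNReal.add_lt_top.2
          ⟨ENNReal.rpow_lt_top_of_nonneg hp0.le ENNReal.ofReal_ne_top, hmom⟩)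
  · refine lt_of_le_of_lt ?_ hδε
    have hpair : Measurable (fun z : ℝ × ProbabilityMeasure ℝ => ((T z, z.2), z)) := by fun_prop
    have hI : Iemb (P.map T ⊗ₘ κ) = P.map (fun z => (T z, z.2)) := by
      rw [Iemb_compProd _ κ fun _ => rfl, Measure.map_map (by fun_prop) hT]
      congr 1
      funext z
      simp [hGT]
    rw [WNested, one_div, ENNReal.rpow_inv_le_iff hp0]
    have hmem : P.map (fun z => ((T z, z.2), z)) ∈ coupling (Iemb (P.map T ⊗ₘ κ)) P := by
      constructor
      · rw [Measure.map_map measurable_fst hpair, hI]; rfl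
      · rw [Measure.map_map measurable_snd hpair]; exact Measure.map_id
    refine (iInf_le _ ⟨_, hmem⟩).trans ((lintegral_map_le _ _).trans ?_)
    calc _ ≤ ∫⁻ _, ENNReal.ofReal δ ^ p ∂P := by
          refine lintegral_mono fun z => ?_
          simp only [Wp_self hp0 hd, ENNReal.zero_rpow_of_pos hp0, add_zero]
          rw [← ENNReal.ofReal_rpow_of_nonneg (hd.nonneg _ _) hp0.le]
          gcongr
          exact hTd z
      _ = _ := by simp
end
end

section
/- The weak nested topology on 𝒫(ℝ²) — that is, the initial topology induced by the map I : 𝒫(ℝ²) → 𝒫(ℝ × 𝒫(ℝ)), where 𝒫(ℝ) and 𝒫(ℝ × 𝒫(ℝ)) carry the topologies of weak convergence — is Polish: 𝒫(ℝ²) with this topology is separable and completely metrizable. -/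
open MeasureTheory ProbabilityTheory Filter
open scoped ENNReal NNReal Topology

noncomputable section

/-- The embedding `I`, as a map between spaces of probability measures (with a junk value
in the never-occurring case that `I[μ]` is not a probability measure). -/
def IembP (μ : ProbabilityMeasure (ℝ × ℝ)) : ProbabilityMeasure (ℝ × ProbabilityMeasure ℝ) :=
  haveI := Classical.dec (IsProbabilityMeasure (Iemb (μ : Measure (ℝ × ℝ))))
  if h : IsProbabilityMeasure (Iemb (μ : Measure (ℝ × ℝ))) then
    ⟨Iemb (μ : Measure (ℝ × ℝ)), h⟩
  else
    ⟨Measure.dirac ((0 : ℝ), (⟨Measure.dirac 0, inferInstance⟩ : ProbabilityMeasure ℝ)),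
      inferInstance⟩

/-- The weak nested topology on `𝒫(ℝ²)`: the initial topology for
`I : 𝒫(ℝ²) → 𝒫(ℝ × 𝒫(ℝ))`, where the target carries the topology of weak convergence. -/
def weakNestedTopology : TopologicalSpace (ProbabilityMeasure (ℝ × ℝ)) :=
  TopologicalSpace.induced IembP inferInstance

section Polish

open Set TopologicalSpace Topology

/-- A space that embeds into a Polish space with `Gδ` range is Polish. -/
theorem Topology.IsEmbedding.polishSpace_of_isGδ_range {X Y : Type*} [TopologicalSpace X]
    [TopologicalSpace Y] [PolishSpace Y] {f : X → Y} (hf : IsEmbedding f)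
    (hG : IsGδ (range f)) : PolishSpace X := by
  obtain ⟨U, hU, hrange⟩ := isGδ_iff_eq_iInter_nat.1 hG
  have hmem (x : X) (n : ℕ) : f x ∈ U n := mem_iInter.1 (hrange ▸ mem_range_self x) n
  have (n : ℕ) : PolishSpace (U n) := (hU n).polishSpace
  let φ : X → Π n, U n := fun x n => ⟨f x, hmem x n⟩
  have hφ : Continuous φ := continuous_pi fun n => hf.continuous.subtype_mk _
  have hemb : IsEmbedding φ :=
    IsEmbedding.of_comp (f := φ) (g := fun z : Π n, U n => (z 0 : Y)) hφ (by fun_prop) hf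
  refine IsClosedEmbedding.polishSpace (f := φ) ⟨hemb, ?_⟩
  have : range φ = ⋂ n, {z : Π n, U n | (z n : Y) = z 0} := by
    ext z
    simp only [mem_range, mem_iInter, mem_ofPred_eq]
    constructor
    · rintro ⟨x, rfl⟩ n
      rfl
    · intro h
      have : (z 0 : Y) ∈ range f := hrange ▸ mem_iInter.2 fun n => h n ▸ (z n).2
      obtain ⟨x, hx⟩ := this
      exact ⟨x, funext fun n => Subtype.ext (hx.trans (h n).symm)⟩
  rw [this]
  exact isClosed_iInter fun n => isClosed_eq (by fun_prop) (by fun_prop)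

/-- A completely metrizable space has `Gδ` range under any embedding into a metrizable space. -/
theorem Topology.IsEmbedding.isGδ_range {X Y : Type*} [TopologicalSpace X]
    [IsCompletelyMetrizableSpace X] [TopologicalSpace Y] [MetrizableSpace Y] {f : X → Y}
    (hf : IsEmbedding f) : IsGδ (range f) := by
  let := upgradeIsCompletelyMetrizable X
  let := metrizableSpaceMetric Y
  let W (n : ℕ) : Set Y :=
    ⋃₀ {V | IsOpen V ∧ ∀ a b, f a ∈ V → f b ∈ V → dist a b < 1 / ((n : ℝ) + 1)}
  have hW (n : ℕ) : IsOpen (W n) := isOpen_sUnion fun V hV => hV.1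
  have key : range f = closure (range f) ∩ ⋂ n, W n := by
    ext y
    constructor
    · rintro ⟨x, rfl⟩
      refine ⟨subset_closure (mem_range_self x), mem_iInter.2 fun n => ?_⟩
      obtain ⟨V, hVo, hV⟩ := hf.isOpen_iff.1
        (Metric.isOpen_ball (x := x) (ε := 1 / ((n : ℝ) + 1) / 2))
      refine ⟨V, ⟨hVo, fun a b ha hb => ?_⟩, ?_⟩
      · have ha' : a ∈ f ⁻¹' V := ha
        have hb' : b ∈ f ⁻¹' V := hb
        rw [hV, Metric.mem_ball] at ha' hb'
        linarith [dist_triangle_right a b x]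
      · change x ∈ f ⁻¹' V
        rw [hV]
        exact Metric.mem_ball_self (by positivity)
    · rintro ⟨hcl, hy⟩
      have hne : (comap f (𝓝 y)).NeBot := by
        rw [comap_neBot_iff_frequently]
        exact mem_closure_iff_frequently.1 hcl
      have hC : Cauchy (comap f (𝓝 y)) := by
        refine Metric.cauchy_iff.2 ⟨hne, fun ε hε => ?_⟩
        obtain ⟨n, hn⟩ := exists_nat_one_div_lt hε
        obtain ⟨V, ⟨hVo, hV⟩, hyV⟩ := mem_iInter.1 hy n
        exact ⟨f ⁻¹' V, preimage_mem_comap (hVo.mem_nhds hyV),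
          fun a ha b hb => (hV a b ha hb).trans hn⟩
      obtain ⟨x, hx⟩ := CompleteSpace.complete hC
      exact ⟨x, tendsto_nhds_unique ((hf.continuous.tendsto x).mono_left hx) tendsto_comap⟩
  rw [key]
  exact isClosed_closure.isGδ.inter (IsGδ.iInter_of_isOpen hW)

theorem MeasureTheory.ProbabilityMeasure.isOpen_setOf_lt_measure {X : Type*} [TopologicalSpace X]
    [MeasurableSpace X] [OpensMeasurableSpace X] [HasOuterApproxClosed X] {U : Set X}
    (hU : IsOpen U) (r : ℝ≥0∞) :
    IsOpen {μ : ProbabilityMeasure X | r < (μ : Measure X) U} := by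
  refine isOpen_iff_mem_nhds.2 fun μ hμ => ?_
  exact eventually_lt_of_lt_liminf (lt_of_lt_of_le hμ
    (ProbabilityMeasure.le_liminf_measure_open_of_tendsto (μs := id) tendsto_id hU))

/-- Pushforward along an embedding of separable metrizable spaces with measurable range is
an embedding for the weak topologies. -/
theorem MeasureTheory.ProbabilityMeasure.isEmbedding_map {X Y : Type*} [TopologicalSpace X]
    [SecondCountableTopology X] [MetrizableSpace X] [MeasurableSpace X] [BorelSpace X]
    [TopologicalSpace Y] [SecondCountableTopology Y] [MetrizableSpace Y] [MeasurableSpace Y]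
    [BorelSpace Y] {f : X → Y} (hf : IsEmbedding f) (hr : MeasurableSet (range f)) :
    IsEmbedding
      (fun μ : ProbabilityMeasure X => μ.map (f := f) hf.continuous.aemeasurable) := by
  have hm : MeasurableEmbedding f := hf.measurableEmbedding hr
  refine ⟨⟨?_⟩, fun μ ν h => ?_⟩
  · refine le_antisymm (ProbabilityMeasure.continuous_map hf.continuous).le_induced ?_
    refine le_of_nhds_le_nhds fun μ => ?_
    rw [nhds_induced]
    refine tendsto_of_forall_isOpen_le_liminf' (μs := id) (L := comap _ _) fun G hG => ?_
    obtain ⟨V, hV, rfl⟩ := hf.isOpen_iff.1 hG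
    have := ProbabilityMeasure.le_liminf_measure_open_of_tendsto
      (tendsto_comap (f := fun μ : ProbabilityMeasure X =>
        μ.map (f := f) hf.continuous.aemeasurable)
        (x := 𝓝 (μ.map hf.continuous.aemeasurable))) hV
    simpa [ProbabilityMeasure.toMeasure_map,
      Measure.map_apply hf.continuous.measurable hV.measurableSet] using this
  · have h' : (μ : Measure X).map f = (ν : Measure X).map f := congrArg Subtype.val h
    apply Subtype.ext
    have := congrArg (Measure.comap f) h'
    rwa [hm.comap_map, hm.comap_map] at this

/-- The space of Borel probability measures on a Polish space is Polish. -/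
instance MeasureTheory.ProbabilityMeasure.instPolishSpace {X : Type*} [TopologicalSpace X]
    [PolishSpace X] [MeasurableSpace X] [BorelSpace X] : PolishSpace (ProbabilityMeasure X) := by
  let := upgradeIsCompletelyMetrizable X
  obtain ⟨e, he⟩ := Metric.PiNatEmbed.exists_embedding_to_hilbert_cube (X := X)
  obtain ⟨U, hU, hrange⟩ := isGδ_iff_eq_iInter_nat.1 he.isGδ_range
  have hr : MeasurableSet (range e) := he.isGδ_range.measurableSet
  have hm : MeasurableEmbedding e := he.measurableEmbedding hr
  have : PolishSpace (ProbabilityMeasure (ℕ → unitInterval)) := by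
    let := metrizableSpaceMetric (ProbabilityMeasure (ℕ → unitInterval))
    infer_instance
  refine (ProbabilityMeasure.isEmbedding_map he hr).polishSpace_of_isGδ_range ?_
  have key : range (fun μ : ProbabilityMeasure X => μ.map (f := e) he.continuous.aemeasurable) =
      ⋂ n, ⋂ m : ℕ, {ν : ProbabilityMeasure (ℕ → unitInterval) |
        1 - ((m : ℝ≥0∞) + 1)⁻¹ < (ν : Measure (ℕ → unitInterval)) (U n)} := by
    ext ν
    simp only [mem_range, mem_iInter, mem_ofPred_eq]
    constructor
    · rintro ⟨μ, rfl⟩ n m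
      rw [ProbabilityMeasure.toMeasure_map,
        Measure.map_apply he.continuous.measurable (hU n).measurableSet,
        show e ⁻¹' U n = univ from eq_univ_of_forall fun x =>
          mem_iInter.1 (hrange ▸ mem_range_self x) n, measure_univ]
      exact ENNReal.sub_lt_self (by simp) (by simp) (by simp)
    · intro h
      have h1 (n : ℕ) : (ν : Measure (ℕ → unitInterval)) (U n) = 1 := by
        refine le_antisymm prob_le_one (ENNReal.le_of_forall_pos_le_add fun ε hε _ => ?_)
        obtain ⟨m, hm⟩ := ENNReal.exists_inv_nat_lt (a := (ε : ℝ≥0∞)) (by simpa using hε.ne')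
        refine tsub_le_iff_right.1 (le_trans ?_ (h n m).le)
        gcongr
        exact le_trans (ENNReal.inv_le_inv.2 le_self_add) hm.le
      have h2 : (ν : Measure (ℕ → unitInterval)) (range e)ᶜ = 0 := by
        rw [hrange, compl_iInter, measure_iUnion_null_iff]
        intro n
        exact (prob_compl_eq_zero_iff (hU n).measurableSet).2 (h1 n)
      have h3 : ((ν : Measure (ℕ → unitInterval)).comap e).map e = ν := by
        rw [hm.map_comap, Measure.restrict_eq_self_of_ae_mem]
        exact h2
      have hp : IsProbabilityMeasure ((ν : Measure (ℕ → unitInterval)).comap e) := by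
        constructor
        rw [hm.comap_apply, image_univ, ← prob_compl_eq_zero_iff hr]
        exact h2
      exact ⟨⟨_, hp⟩, Subtype.ext h3⟩
  rw [key]
  exact .iInter fun n => .iInter fun m =>
    (ProbabilityMeasure.isOpen_setOf_lt_measure (hU n) _).isGδ

end Polish

section Graph

open Set TopologicalSpace

/-- If `f` is an `L¹(Q)`-limit of functions of the first coordinate, it is `Q`-almost everywhere
a measurable function of the first coordinate. -/
theorem MeasureTheory.exists_measurable_ae_eq_comp_fst {X Y : Type*} [MeasurableSpace X]
    [MeasurableSpace Y] {Q : Measure (X × Y)} {f : X × Y → ℝ} (hf : Integrable f Q)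
    {g : ℕ → X → ℝ} (hg : ∀ n, Measurable (g n)) (hgi : ∀ n, Integrable (fun z => g n z.1) Q)
    (hlim : Tendsto (fun n => ∫ z, ‖g n z.1 - f z‖ ∂Q) atTop (𝓝 0)) :
    ∃ h : X → ℝ, Measurable h ∧ ∀ᵐ z ∂Q, f z = h z.1 := by
  have hL : Tendsto (fun n => eLpNorm ((fun z : X × Y => g n z.1) - f) 1 Q) atTop (𝓝 0) := by
    have := ENNReal.tendsto_ofReal hlim
    rw [ENNReal.ofReal_zero] at this
    refine this.congr fun n => ?_
    rw [eLpNorm_one_eq_lintegral_enorm]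
    exact ofReal_integral_norm_eq_lintegral_enorm ((hgi n).sub hf)
  obtain ⟨ns, -, hns⟩ := (tendstoInMeasure_of_tendsto_eLpNorm one_ne_zero
    (fun n => (hgi n).aestronglyMeasurable) hf.aestronglyMeasurable hL).exists_seq_tendsto_ae
  refine ⟨fun x => limsup (fun i => g (ns i) x) atTop, Measurable.limsup fun i => hg _, ?_⟩
  filter_upwards [hns] with z hz
  exact hz.limsup_eq.symm

/-- The probability measures on a product of Polish spaces that are concentrated on the graph of
a measurable function form a `Gδ` set. -/
theorem MeasureTheory.ProbabilityMeasure.isGδ_setOf_exists_ae_eq_graph {X Y : Type*}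
    [TopologicalSpace X] [PolishSpace X] [MeasurableSpace X] [BorelSpace X]
    [TopologicalSpace Y] [PolishSpace Y] [MeasurableSpace Y] [BorelSpace Y] [Nonempty Y] :
    IsGδ {Q : ProbabilityMeasure (X × Y) |
      ∃ G : X → Y, Measurable G ∧ ∀ᵐ z ∂(Q : Measure (X × Y)), z.2 = G z.1} := by
  let := metrizableSpaceMetric Y
  obtain ⟨e, he⟩ := Metric.PiNatEmbed.exists_embedding_to_hilbert_cube (X := Y)
  have hek (k : ℕ) : Continuous fun y => (e y k : ℝ) :=
    continuous_subtype_val.comp ((continuous_apply k).comp he.continuous)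
  have hbound (k : ℕ) (y : Y) : ‖(e y k : ℝ)‖ ≤ 1 := by
    rw [Real.norm_of_nonneg (e y k).2.1]
    exact (e y k).2.2
  let c (k : ℕ) : BoundedContinuousFunction (X × Y) ℝ :=
    BoundedContinuousFunction.ofNormedAddCommGroup (fun z => (e z.2 k : ℝ))
      ((hek k).comp continuous_snd) 1 fun z => hbound k z.2
  let b (g : BoundedContinuousFunction X ℝ) : BoundedContinuousFunction (X × Y) ℝ :=
    g.compContinuous ⟨Prod.fst, continuous_fst⟩
  let d (k : ℕ) (g : BoundedContinuousFunction X ℝ) : BoundedContinuousFunction (X × Y) ℝ :=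
    BoundedContinuousFunction.ofNormedAddCommGroup (fun z => ‖(b g - c k) z‖)
      (b g - c k).continuous.norm ‖b g - c k‖
      fun z => by simpa using (b g - c k).norm_coe_le_norm z
  have key : {Q : ProbabilityMeasure (X × Y) |
      ∃ G : X → Y, Measurable G ∧ ∀ᵐ z ∂(Q : Measure (X × Y)), z.2 = G z.1} =
      ⋂ k, ⋂ n : ℕ, ⋃ g, {Q : ProbabilityMeasure (X × Y) |
        ∫ z, d k g z ∂(Q : Measure (X × Y)) < 1 / ((n : ℝ) + 1)} := by
    ext Q
    simp only [mem_ofPred_eq, mem_iInter, mem_iUnion]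
    constructor
    · rintro ⟨G, hG, hQ⟩ k n
      let := metrizableSpaceMetric X
      have hmeas : Measurable fun x => (e (G x) k : ℝ) := (hek k).measurable.comp hG
      have hint : Integrable (fun x => (e (G x) k : ℝ)) ((Q : Measure (X × Y)).map Prod.fst) :=
        .of_bound (C := 1) hmeas.aestronglyMeasurable (ae_of_all _ fun x => hbound k (G x))
      have hε : (0 : ℝ) < 1 / ((n : ℝ) + 1) / 2 := by positivity
      have : IsProbabilityMeasure ((Q : Measure (X × Y)).map Prod.fst) :=
        Measure.isProbabilityMeasure_map measurable_fst.aemeasurable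
      obtain ⟨g, hg, -⟩ := hint.exists_boundedContinuous_integral_sub_le hε
      refine ⟨g, lt_of_le_of_lt (le_trans (le_of_eq ?_) hg) (half_lt_self (by positivity))⟩
      have hsub : Measurable fun x => ‖(e (G x) k : ℝ) - g x‖ :=
        (hmeas.sub g.continuous.measurable).norm
      rw [integral_map measurable_fst.aemeasurable hsub.aestronglyMeasurable]
      refine integral_congr_ae ?_
      filter_upwards [hQ] with z hz
      change ‖g z.1 - (e z.2 k : ℝ)‖ = _
      rw [norm_sub_rev, hz]
    · intro h
      have hk (k : ℕ) : ∃ h : X → ℝ, Measurable h ∧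
          ∀ᵐ z ∂(Q : Measure (X × Y)), (e z.2 k : ℝ) = h z.1 := by
        choose g hg using h k
        refine exists_measurable_ae_eq_comp_fst (f := c k) ((c k).integrable _)
          (fun n => (g n).continuous.measurable) (fun n => (b (g n)).integrable _) ?_
        exact squeeze_zero (fun n => integral_nonneg fun z => norm_nonneg _)
          (fun n => (hg n).le) tendsto_one_div_add_atTop_nhds_zero_nat
      choose h hh hhQ using hk
      have hme : MeasurableEmbedding fun (y : Y) (k : ℕ) => (e y k : ℝ) :=
        (measurable_pi_lambda _ fun k => (hek k).measurable).measurableEmbedding fun y y' hy =>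
          he.injective (funext fun k => Subtype.ext (congrFun hy k))
      obtain ⟨r, hr, hre⟩ := hme.exists_measurable_extend measurable_id fun _ => ‹Nonempty Y›
      refine ⟨fun x => r fun k => h k x, hr.comp (measurable_pi_lambda _ hh), ?_⟩
      filter_upwards [ae_all_iff.2 hhQ] with z hz
      simp_rw [← hz]
      exact (congrFun hre z.2).symm
  rw [key]
  exact .iInter fun k => .iInter fun n => IsOpen.isGδ <| isOpen_iUnion fun g =>
    isOpen_lt (ProbabilityMeasure.continuous_integral_boundedContinuousFunction _)
      continuous_const

end Graph

theorem measurable_coe_probabilityMeasure_real :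
    Measurable fun p : ProbabilityMeasure ℝ => (p : Measure ℝ) := by
  refine .measure_of_isPiSystem_of_isProbabilityMeasure (S := {s | IsOpen s})
    BorelSpace.measurable_eq isPiSystem_isOpen fun s hs => ?_
  exact measurable_of_Ioi fun r =>
    (ProbabilityMeasure.isOpen_setOf_lt_measure (U := s) hs r).measurableSet

theorem measurable_probabilityMeasure_real_of_coe {X : Type*} [MeasurableSpace X]
    {G : X → ProbabilityMeasure ℝ} (hG : Measurable fun x => (G x : Measure ℝ)) :
    Measurable G := by
  let F : ProbabilityMeasure ℝ → ℚ → ℝ≥0∞ := fun p q => (p : Measure ℝ) (Set.Iic (q : ℝ))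
  have hF : Measurable F := measurable_pi_lambda _ fun q =>
    (Measure.measurable_coe measurableSet_Iic).comp measurable_coe_probabilityMeasure_real
  have hinj : Function.Injective F := fun p p' h => by
    refine ProbabilityMeasure.toMeasure_injective ?_
    refine ext_of_generate_finite _
      (BorelSpace.measurable_eq.trans Real.borel_eq_generateFrom_Iic_rat)
      Real.isPiSystem_Iic_rat (fun s hs => ?_) (by simp)
    obtain ⟨q, hq⟩ := Set.mem_iUnion.1 hs
    obtain rfl : s = Set.Iic (q : ℝ) := hq
    exact congrFun h q
  refine (hF.measurableEmbedding hinj).measurable_comp_iff.1 (measurable_pi_lambda _ fun q => ?_)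
  exact (Measure.measurable_coe measurableSet_Iic).comp hG

theorem coe_condPM (μ : Measure (ℝ × ℝ)) [IsFiniteMeasure μ] (x : ℝ) :
    (condPM μ x : Measure ℝ) = μ.condKernel x :=
  congrArg (fun p : ProbabilityMeasure ℝ => (p : Measure ℝ))
    (dif_pos (inferInstance : IsFiniteMeasure μ))

theorem measurable_condPM (μ : Measure (ℝ × ℝ)) [IsFiniteMeasure μ] : Measurable (condPM μ) :=
  measurable_probabilityMeasure_real_of_coe <| by
    simpa only [coe_condPM] using μ.condKernel.measurable

theorem coe_IembP (μ : ProbabilityMeasure (ℝ × ℝ)) :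
    (IembP μ : Measure (ℝ × ProbabilityMeasure ℝ)) =
      (μ : Measure (ℝ × ℝ)).fst.map fun x => (x, condPM μ x) := by
  have : IsProbabilityMeasure ((μ : Measure (ℝ × ℝ)).map Prod.fst) :=
    Measure.isProbabilityMeasure_map measurable_fst.aemeasurable
  have : IsProbabilityMeasure (Iemb (μ : Measure (ℝ × ℝ))) :=
    Measure.isProbabilityMeasure_map
      (measurable_id'.prodMk (measurable_condPM (μ : Measure (ℝ × ℝ)))).aemeasurable
  exact congrArg (fun Q : ProbabilityMeasure (ℝ × ProbabilityMeasure ℝ) =>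
    (Q : Measure (ℝ × ProbabilityMeasure ℝ))) (dif_pos this)

/-- `μ` is recovered from `I[μ]` by averaging the second coordinate. -/
theorem lintegral_IembP (μ : ProbabilityMeasure (ℝ × ℝ)) {s : Set (ℝ × ℝ)}
    (hs : MeasurableSet s) :
    ∫⁻ z, (z.2 : Measure ℝ) (Prod.mk z.1 ⁻¹' s) ∂(IembP μ : Measure (ℝ × ProbabilityMeasure ℝ)) =
      (μ : Measure (ℝ × ℝ)) s := by
  let κ : Kernel (ℝ × ProbabilityMeasure ℝ) ℝ :=
    ⟨fun z => (z.2 : Measure ℝ), measurable_coe_probabilityMeasure_real.comp measurable_snd⟩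
  have : IsMarkovKernel κ := ⟨fun z => z.2.2⟩
  have hmeas : Measurable fun z : ℝ × ProbabilityMeasure ℝ =>
      (z.2 : Measure ℝ) (Prod.mk z.1 ⁻¹' s) :=
    Kernel.measurable_kernel_prodMk_left (κ := κ)
      (t := (fun p : (ℝ × ProbabilityMeasure ℝ) × ℝ => (p.1.1, p.2)) ⁻¹' s)
      ((by fun_prop : Measurable fun p : (ℝ × ProbabilityMeasure ℝ) × ℝ => (p.1.1, p.2)) hs)
  rw [coe_IembP, lintegral_map hmeas
    (measurable_id'.prodMk (measurable_condPM (μ : Measure (ℝ × ℝ))))]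
  conv_rhs => rw [← (μ : Measure (ℝ × ℝ)).disintegrate (μ : Measure (ℝ × ℝ)).condKernel,
    Measure.compProd_apply hs]
  simp only [coe_condPM]

theorem IembP_injective : Function.Injective IembP := fun μ ν h => by
  refine ProbabilityMeasure.toMeasure_injective (Measure.ext fun s hs => ?_)
  rw [← lintegral_IembP μ hs, ← lintegral_IembP ν hs, h]

/-- The range of `I` consists of the measures concentrated on the graph of a measurable
function. -/
theorem range_IembP : Set.range IembP = {Q : ProbabilityMeasure (ℝ × ProbabilityMeasure ℝ) |
    ∃ G : ℝ → ProbabilityMeasure ℝ, Measurable G ∧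
      ∀ᵐ z ∂(Q : Measure (ℝ × ProbabilityMeasure ℝ)), z.2 = G z.1} := by
  ext Q
  constructor
  · rintro ⟨μ, rfl⟩
    have hm := measurable_condPM (μ : Measure (ℝ × ℝ))
    refine ⟨condPM μ, hm, ?_⟩
    rw [coe_IembP]
    exact (ae_map_iff (measurable_id'.prodMk hm).aemeasurable
      (measurableSet_eq_fun measurable_snd (hm.comp measurable_fst))).2 (ae_of_all _ fun x => rfl)
  · rintro ⟨G, hG, hQ⟩
    let κ : Kernel ℝ ℝ :=
      ⟨fun x => (G x : Measure ℝ), measurable_coe_probabilityMeasure_real.comp hG⟩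
    have : IsMarkovKernel κ := ⟨fun x => (G x).2⟩
    let μ : ProbabilityMeasure (ℝ × ℝ) :=
      ⟨(Q : Measure (ℝ × ProbabilityMeasure ℝ)).fst ⊗ₘ κ, inferInstance⟩
    have hfst : (μ : Measure (ℝ × ℝ)).fst = (Q : Measure (ℝ × ProbabilityMeasure ℝ)).fst :=
      Measure.fst_compProd _ _
    have hcond : ∀ᵐ x ∂(μ : Measure (ℝ × ℝ)).fst, condPM μ x = G x := by
      have := eq_condKernel_of_measure_eq_compProd (ρ := (μ : Measure (ℝ × ℝ))) κ
        (by rw [hfst]; rfl)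
      filter_upwards [this] with x hx
      exact ProbabilityMeasure.toMeasure_injective ((coe_condPM _ x).trans hx.symm)
    refine ⟨μ, ProbabilityMeasure.toMeasure_injective ?_⟩
    rw [coe_IembP, Measure.map_congr (g := fun x => (x, G x)) (hcond.mono fun x hx => by simp [hx]),
      hfst, Measure.fst, Measure.map_map (measurable_id'.prodMk hG) measurable_fst]
    conv_rhs => rw [← Measure.map_id (μ := (Q : Measure (ℝ × ProbabilityMeasure ℝ)))]
    exact Measure.map_congr (hQ.mono fun z hz => Prod.ext rfl hz.symm)

/-- the weak nested topology on `𝒫(ℝ²)` is Polish. -/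
theorem weakNestedTopology_polishSpace :
    @PolishSpace (ProbabilityMeasure (ℝ × ℝ)) weakNestedTopology := by
  let := weakNestedTopology
  have hemb : Topology.IsEmbedding IembP := ⟨⟨rfl⟩, IembP_injective⟩
  refine hemb.polishSpace_of_isGδ_range ?_
  rw [range_IembP]
  exact ProbabilityMeasure.isGδ_setOf_exists_ae_eq_graph
end
end

section
/- Let μ be a Borel probability measure on ℝ^N and let T : ℝ^N → ℝ^N be Borel and adapted, i.e., the i-th coordinate of T(x₁,…,x_N) depends only on (x₁,…,x_i) for each i. Then γ := (id,T)_*μ is an extreme point of Π_c(μ,·): γ ∈ Π_c(μ,·), and whenever γ = λπ + (1−λ)π' with π, π' ∈ Π_c(μ,·) and λ ∈ (0,1), then π = π' = γ. -/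
open MeasureTheory ProbabilityTheory Filter
open scoped ENNReal NNReal Topology

noncomputable section

/-- Projection onto the first `t` coordinates. -/
def proj (N t : ℕ) (ht : t ≤ N) (x : Fin N → ℝ) : Fin t → ℝ :=
  fun i => x (Fin.castLE ht i)

/-- The σ-algebra generated by the first `t` coordinates of the first (`x`) component. -/
def sigmaX (N t : ℕ) (ht : t ≤ N) : MeasurableSpace ((Fin N → ℝ) × (Fin N → ℝ)) :=
  MeasurableSpace.comap (fun z => proj N t ht z.1) inferInstance

/-- The σ-algebra generated by the first `t` coordinates of the second (`y`) component. -/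
def sigmaY (N t : ℕ) (ht : t ≤ N) : MeasurableSpace ((Fin N → ℝ) × (Fin N → ℝ)) :=
  MeasurableSpace.comap (fun z => proj N t ht z.2) inferInstance

/-- The σ-algebra generated by all coordinates of the first (`x`) component. -/
def sigmaXfull (N : ℕ) : MeasurableSpace ((Fin N → ℝ) × (Fin N → ℝ)) :=
  MeasurableSpace.comap Prod.fst inferInstance

/-- The σ-algebra generated by all coordinates of the second (`y`) component. -/
def sigmaYfull (N : ℕ) : MeasurableSpace ((Fin N → ℝ) × (Fin N → ℝ)) :=
  MeasurableSpace.comap Prod.snd inferInstance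

/-- A coupling `γ`, viewed as the joint law of processes `X, Y`, is bicausal if for every
`t < N` and Borel `B ⊆ ℝ^t`, `ℙ((Y₁,…,Y_t) ∈ B | X₁,…,X_N) = ℙ((Y₁,…,Y_t) ∈ B | X₁,…,X_t)`
a.s. and symmetrically in `X` and `Y`. -/
def Bicausal (N : ℕ) (γ : Measure ((Fin N → ℝ) × (Fin N → ℝ))) : Prop :=
  ∀ (t : ℕ) (ht : t < N) (B : Set (Fin t → ℝ)), MeasurableSet B →
    (γ[fun z => Set.indicator B (fun _ => (1 : ℝ)) (proj N t ht.le z.2) | sigmaXfull N]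
      =ᵐ[γ]
     γ[fun z => Set.indicator B (fun _ => (1 : ℝ)) (proj N t ht.le z.2) | sigmaX N t ht.le]) ∧
    (γ[fun z => Set.indicator B (fun _ => (1 : ℝ)) (proj N t ht.le z.1) | sigmaYfull N]
      =ᵐ[γ]
     γ[fun z => Set.indicator B (fun _ => (1 : ℝ)) (proj N t ht.le z.1) | sigmaY N t ht.le])

/-- A probability measure `γ` on `ℝ^N × ℝ^N`, viewed as the joint law of processes
`X, Y`, is causal if for every `t < N` and Borel `B ⊆ ℝ^t`,
`ℙ((Y₁,…,Y_t) ∈ B | X₁,…,X_N) = ℙ((Y₁,…,Y_t) ∈ B | X₁,…,X_t)` a.s. -/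
def Causal (N : ℕ) (γ : Measure ((Fin N → ℝ) × (Fin N → ℝ))) : Prop :=
  ∀ (t : ℕ) (ht : t < N) (B : Set (Fin t → ℝ)), MeasurableSet B →
    γ[fun z => Set.indicator B (fun _ => (1 : ℝ)) (proj N t ht.le z.2) | sigmaXfull N]
      =ᵐ[γ]
    γ[fun z => Set.indicator B (fun _ => (1 : ℝ)) (proj N t ht.le z.2) | sigmaX N t ht.le]

/-- `Π_c(μ,·)`: causal couplings with first marginal `μ` and unspecified second marginal. -/
def CausalSet (N : ℕ) (μ : Measure (Fin N → ℝ)) :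
    Set (Measure ((Fin N → ℝ) × (Fin N → ℝ))) :=
  {γ | IsProbabilityMeasure γ ∧ γ.map Prod.fst = μ ∧ Causal N γ}

/-- `Π_bc(μ,·)`: bicausal couplings with first marginal `μ`. -/
def BicausalSet (N : ℕ) (μ : Measure (Fin N → ℝ)) :
    Set (Measure ((Fin N → ℝ) × (Fin N → ℝ))) :=
  {γ | IsProbabilityMeasure γ ∧ γ.map Prod.fst = μ ∧ Bicausal N γ}

/-- `T : ℝ^N → ℝ^N` is adapted: its `i`-th coordinate depends only on the first `i`
coordinates of the argument. -/
def IsAdapted (N : ℕ) (T : (Fin N → ℝ) → (Fin N → ℝ)) : Prop :=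
  ∀ (i : Fin N) (x x' : Fin N → ℝ), (∀ j : Fin N, j ≤ i → x j = x' j) → T x i = T x' i

lemma measurable_proj (N t : ℕ) (ht : t ≤ N) : Measurable (proj N t ht) :=
  measurable_pi_lambda _ fun _ => measurable_pi_apply _

/-- The first `t` coordinates of an adapted Borel map are a Borel function of the first `t`
coordinates of its argument. -/
lemma IsAdapted.exists_measurable_proj_comp {N : ℕ} {T : (Fin N → ℝ) → (Fin N → ℝ)}
    (hTa : IsAdapted N T) (hT : Measurable T) (t : ℕ) (ht : t ≤ N) :
    ∃ G : (Fin t → ℝ) → (Fin t → ℝ), Measurable G ∧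
      ∀ x, proj N t ht (T x) = G (proj N t ht x) := by
  let extend : (Fin t → ℝ) → (Fin N → ℝ) := fun w j => if h : j.val < t then w ⟨j, h⟩ else 0
  have h_extend : Measurable extend := by
    refine measurable_pi_lambda _ fun j => ?_
    by_cases h : j.val < t
    · simpa [extend, h] using measurable_pi_apply _
    · simp [extend, h]
  refine ⟨fun w => proj N t ht (T (extend w)),
    (measurable_proj N t ht).comp (hT.comp h_extend), fun x => funext fun i => ?_⟩
  refine hTa _ _ _ fun j hj => ?_
  have hjt : j.val < t := lt_of_le_of_lt (Fin.le_def.mp hj) i.isLt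
  simp [extend, hjt, proj]

/-- A random variable that is a.e. equal to one measurable with respect to two sub-σ-algebras has
the same conditional expectation given either of them. -/
lemma condExp_ae_eq_condExp_of_ae_eq {Ω : Type*} {m₁ m₂ m₀ : MeasurableSpace Ω}
    {γ : Measure Ω} [IsFiniteMeasure γ] (h₁ : m₁ ≤ m₀) (h₂ : m₂ ≤ m₀) {f g : Ω → ℝ}
    (hfg : f =ᵐ[γ] g) (hg₁ : StronglyMeasurable[m₁] g) (hg₂ : StronglyMeasurable[m₂] g)
    (hg : Integrable g γ) : γ[f | m₁] =ᵐ[γ] γ[f | m₂] := by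
  refine (condExp_congr_ae hfg).trans (EventuallyEq.trans ?_ (condExp_congr_ae hfg).symm)
  rw [condExp_of_stronglyMeasurable h₁ hg₁ hg, condExp_of_stronglyMeasurable h₂ hg₂ hg]

lemma measurable_graph {α β : Type*} [MeasurableSpace α] [MeasurableSpace β] {T : α → β}
    (hT : Measurable T) : Measurable fun x => (x, T x) :=
  measurable_id.prodMk hT

lemma ae_snd_eq_of_map_graph {α β : Type*} [MeasurableSpace α] [MeasurableSpace β]
    [MeasurableEq β] {μ : Measure α} {T : α → β} (hT : Measurable T) :
    ∀ᵐ z ∂μ.map (fun x => (x, T x)), z.2 = T z.1 := by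
  refine (ae_map_iff (measurable_graph hT).aemeasurable
    (measurableSet_eq_fun measurable_snd (hT.comp measurable_fst))).2 ?_
  exact Eventually.of_forall fun _ => rfl

/-- A measure concentrated on the graph of `T` is determined by its first marginal. -/
lemma eq_map_graph_of_ae_snd_eq {α β : Type*} [MeasurableSpace α] [MeasurableSpace β]
    {π : Measure (α × β)} {T : α → β} (hT : Measurable T) (h : ∀ᵐ z ∂π, z.2 = T z.1) :
    π = (π.map Prod.fst).map (fun x => (x, T x)) := by
  rw [Measure.map_map (measurable_graph hT) measurable_fst]
  conv_lhs => rw [← Measure.map_id (μ := π)]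
  refine Measure.map_congr ?_
  filter_upwards [h] with z hz
  exact Prod.ext rfl hz

lemma causal_map_graph {N : ℕ} (μ : Measure (Fin N → ℝ)) [IsProbabilityMeasure μ]
    {T : (Fin N → ℝ) → (Fin N → ℝ)} (hT : Measurable T) (hTa : IsAdapted N T) :
    Causal N (μ.map (fun x => (x, T x))) := by
  intro t ht B hB
  have : IsProbabilityMeasure (μ.map (fun x => (x, T x))) :=
    Measure.isProbabilityMeasure_map (measurable_graph hT).aemeasurable
  obtain ⟨G, hG, hTG⟩ := hTa.exists_measurable_proj_comp hT t ht.le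
  have h_ind : Measurable fun w => B.indicator (fun _ => (1 : ℝ)) (G w) :=
    (measurable_const.indicator hB).comp hG
  have h_fst : Measurable[sigmaXfull N] (Prod.fst : (Fin N → ℝ) × (Fin N → ℝ) → _) :=
    comap_measurable _
  have h_proj : Measurable[sigmaX N t ht.le]
      fun z : (Fin N → ℝ) × (Fin N → ℝ) => proj N t ht.le z.1 :=
    comap_measurable _
  have h_le : sigmaXfull N ≤ (inferInstance : MeasurableSpace ((Fin N → ℝ) × (Fin N → ℝ))) :=
    measurable_fst.comap_le
  have hg : Measurable[sigmaXfull N] fun z : (Fin N → ℝ) × (Fin N → ℝ) =>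
      B.indicator (fun _ => (1 : ℝ)) (G (proj N t ht.le z.1)) :=
    h_ind.comp ((measurable_proj N t ht.le).comp h_fst)
  refine condExp_ae_eq_condExp_of_ae_eq
    (g := fun z => B.indicator (fun _ => (1 : ℝ)) (G (proj N t ht.le z.1)))
    h_le ((measurable_proj N t ht.le).comp measurable_fst).comap_le ?_
    hg.stronglyMeasurable (h_ind.comp h_proj).stronglyMeasurable ?_
  · filter_upwards [ae_snd_eq_of_map_graph (μ := μ) hT] with z hz
    rw [hz, hTG]
  · refine Integrable.of_bound (hg.mono h_le le_rfl).aestronglyMeasurable 1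
      (Eventually.of_forall fun z => ?_)
    exact (norm_indicator_le_norm_self _ _).trans (by simp)

/-- for `T` Borel and adapted, `γ = (id,T)_*μ` is an extreme point of
`Π_c(μ,·)`. -/
theorem adapted_monge_extreme (N : ℕ) (μ : Measure (Fin N → ℝ)) [IsProbabilityMeasure μ]
    (T : (Fin N → ℝ) → (Fin N → ℝ)) (hT : Measurable T) (hTa : IsAdapted N T) :
    μ.map (fun x => (x, T x)) ∈ CausalSet N μ ∧
    ∀ π π' : Measure ((Fin N → ℝ) × (Fin N → ℝ)),
      π ∈ CausalSet N μ → π' ∈ CausalSet N μ →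
      ∀ lam : ℝ, 0 < lam → lam < 1 →
        μ.map (fun x => (x, T x)) =
          ENNReal.ofReal lam • π + ENNReal.ofReal (1 - lam) • π' →
        π = μ.map (fun x => (x, T x)) ∧ π' = μ.map (fun x => (x, T x)) := by
  refine ⟨⟨Measure.isProbabilityMeasure_map (measurable_graph hT).aemeasurable, ?_,
    causal_map_graph μ hT hTa⟩, ?_⟩
  · rw [Measure.map_map measurable_fst (measurable_graph hT)]
    exact Measure.map_id
  · intro π π' hπ hπ' lam h0 h1 h
    have h_graph := ae_snd_eq_of_map_graph (μ := μ) hT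
    rw [h, ae_add_measure_iff,
      Measure.ae_ennreal_smul_measure_iff (ENNReal.ofReal_pos.mpr h0).ne',
      Measure.ae_ennreal_smul_measure_iff (ENNReal.ofReal_pos.mpr (sub_pos.mpr h1)).ne'] at h_graph
    have hπ_eq := eq_map_graph_of_ae_snd_eq hT h_graph.1
    have hπ'_eq := eq_map_graph_of_ae_snd_eq hT h_graph.2
    rw [hπ.2.1] at hπ_eq
    rw [hπ'.2.1] at hπ'_eq
    exact ⟨hπ_eq, hπ'_eq⟩
end
end
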